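/- In the game G_φ, for every k ≥ 1, every k-realizable history π from v₀ ending at vC₁, and every 1 ≤ i ≤ 2r: the i-th prime p_i divides k if and only if the vertex vx_i occurs in π. -/

import Mathlib

/-- The prefix of length `k` of an infinite word `w`. -/
def wordPrefix {A : Type*} (w : ℕ → A) (k : ℕ) : List A := (List.range k).map w

/-- The history `ρ 0, ρ 1, …, ρ j` of a play `ρ`. -/
def histUpTo {V : Type*} (ρ : ℕ → V) (j : ℕ) : List V := (List.range (j+1)).map ρ

/-- `h` is a history from `v₀`: nonempty, starts at `v₀`, and consecutive vertices
are linked by a nonempty transition language. -/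
def IsHist {V A : Type*} (Δ : V → V → Set (List A)) (v₀ : V) (h : List V) : Prop :=
  h ≠ [] ∧ h.head? = some v₀ ∧ List.Chain' (fun u w => (Δ u w).Nonempty) h

/-- Membership of the play `ρ` in the `k`-outcome of the coalition strategy `σ` from `v₀`. -/
def InOutcome {V A : Type*} (Δ : V → V → Set (List A)) (v₀ : V) (σ : List V → ℕ → A)
    (k : ℕ) (ρ : ℕ → V) : Prop :=
  ρ 0 = v₀ ∧ ∀ j : ℕ, wordPrefix (σ (histUpTo ρ j)) k ∈ Δ (ρ j) (ρ (j+1))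

/-- The coalition strategy `σ` is winning from `v₀` for the safe set `S`. -/
def WinningFrom {V A : Type*} (Δ : V → V → Set (List A)) (S : Set V) (v₀ : V)
    (σ : List V → ℕ → A) : Prop :=
  ∀ k : ℕ, 1 ≤ k → ∀ ρ : ℕ → V, InOutcome Δ v₀ σ k ρ → ∀ j : ℕ, ρ j ∈ S

/-- Auxiliary loop-erasure on reversed histories (most recent vertex first). -/
def zipAux {V : Type*} [DecidableEq V] : List V → List V
  | [] => []
  | v' :: rest =>
    let z := zipAux rest
    if v' ∈ z then z.dropWhile (fun x => decide (x ≠ v')) else v' :: z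

/-- The loop-erasure map `zip` on histories. -/
def zip {V : Type*} [DecidableEq V] (h : List V) : List V := (zipAux h.reverse).reverse

/-- All words of the transition languages are nonempty. -/
def NonemptyWords {V A : Type*} (Δ : V → V → Set (List A)) : Prop :=
  ∀ v w : V, ∀ u ∈ Δ v w, u ≠ ([] : List A)

/-- Completeness of the arena. -/
def CompleteArena {V A : Type*} (Δ : V → V → Set (List A)) : Prop :=
  ∀ v : V, ∀ u : List A, u ≠ [] → ∃ w : V, u ∈ Δ v w

/-- Every unsafe vertex is a sink. -/
def UnsafeSinks {V A : Type*} (Δ : V → V → Set (List A)) (S : Set V) : Prop :=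
  ∀ v ∉ S, Δ v v = {u : List A | u ≠ []} ∧ ∀ w : V, w ≠ v → Δ v w = (∅ : Set (List A))

/-- A language of finite words is regular if it is accepted by a DFA with finitely
many states. -/
def IsRegularLang {A : Type*} (L : Set (List A)) : Prop :=
  ∃ (Q : Type) (_ : Fintype Q) (M : DFA A Q), ∀ u : List A, u ∈ M.accepts ↔ u ∈ L

/-- The strategy `σ` uses the memory set `M`. -/
def UsesMemory {V A : Type*} (Δ : V → V → Set (List A)) (v₀ : V)
    (σ : List V → ℕ → A) (M : Type) : Prop :=
  ∃ (minit : M) (upd : M → V → M) (next : M → V → ℕ → A),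
    ∀ h : List V, IsHist Δ v₀ h → σ h = next (h.tail.foldl upd minit) (h.getLastD v₀)

/-- The alphabet `Σ = {a, b, c, a_1, …, a_{2r}}` of the game `G_φ`
(`idx i` is the letter `a_{i+1}`). -/
inductive QA (r : ℕ) : Type where
  | a : QA r
  | b : QA r
  | c : QA r
  | idx (i : Fin (2 * r)) : QA r
deriving DecidableEq

/-- Vertices of `G_φ` (0-based indexing; `v j` is `v_j` for `0 ≤ j ≤ 2r-1`, `vx i` is
`vx_{i+1}`, `vxbar i` is `vx̄_{i+1}`, `vC h` is `vC_{h+1}`; the identifications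
`v_{2r} = vC_1` and `vC_{m+1} = ⊤` are built in). -/
inductive QV (r m : ℕ) : Type where
  | v (j : Fin (2 * r)) : QV r m
  | vx (i : Fin (2 * r)) : QV r m
  | vxbar (i : Fin (2 * r)) : QV r m
  | vC (h : Fin m) : QV r m
  | top : QV r m
  | bot : QV r m
deriving DecidableEq

/-- The `(i+1)`-st prime number (`Nat.nth Nat.Prime 0 = 2`). -/
noncomputable def prm (i : ℕ) : ℕ := Nat.nth Nat.Prime i

/-- `Σ⁺` over `QA r`. -/
def qSigPlus (r : ℕ) : Set (List (QA r)) := {u | u ≠ []}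

/-- The language of the literal `p = (i, pol)`: `{a_{i+1}^n : n ∈ M_{i+1}}` if `pol` is
true (literal `x_{i+1}`), and `{a_{i+1}^n : n ≥ 1, n ∉ M_{i+1}}` if `pol` is false
(literal `¬x_{i+1}`). -/
def litLang (r : ℕ) (p : Fin (2 * r) × Bool) : Set (List (QA r)) :=
  {u | ∃ n : ℕ, 1 ≤ n ∧ (prm p.1.val ∣ n ↔ p.2 = true) ∧
        u = List.replicate n (QA.idx p.1)}

/-- The explicitly specified transitions of `G_φ`, for `φ` with `2r` variables and `m`
clauses whose literals are given by `lit` (`lit h j = (i, pol)` meaning the `(j+1)`-st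
literal of clause `C_{h+1}` is `x_{i+1}` if `pol` and `¬x_{i+1}` otherwise). -/
noncomputable def qbfMain (r m : ℕ) (lit : Fin m → Fin 3 → Fin (2 * r) × Bool) :
    QV r m → QV r m → Set (List (QA r))
  | QV.v j, QV.vx i =>
      if i = j then
        (if j.val % 2 = 0 then
          {u | ∃ n : ℕ, 1 ≤ n ∧ prm j.val ∣ n ∧ u = List.replicate n QA.a}
        else
          {u | ∃ n : ℕ, 1 ≤ n ∧ prm j.val ∣ n ∧ u = List.replicate n QA.c})
      else ∅
  | QV.v j, QV.vxbar i =>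
      if i = j then
        (if j.val % 2 = 0 then
          {u | ∃ n : ℕ, 1 ≤ n ∧ ¬ prm j.val ∣ n ∧ u = List.replicate n QA.b}
        else
          {u | ∃ n : ℕ, 1 ≤ n ∧ ¬ prm j.val ∣ n ∧ u = List.replicate n QA.c})
      else ∅
  | QV.v j, QV.top =>
      if j.val % 2 = 0 then
        {u | ∃ n : ℕ, 1 ≤ n ∧ ¬ prm j.val ∣ n ∧ u = List.replicate n QA.a} ∪
        {u | ∃ n : ℕ, 1 ≤ n ∧ prm j.val ∣ n ∧ u = List.replicate n QA.b}
      else ∅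
  | QV.vx i, QV.v j => if j.val = i.val + 1 then qSigPlus r else ∅
  | QV.vxbar i, QV.v j => if j.val = i.val + 1 then qSigPlus r else ∅
  | QV.vx i, QV.vC h => if i.val = 2 * r - 1 ∧ h.val = 0 then qSigPlus r else ∅
  | QV.vxbar i, QV.vC h => if i.val = 2 * r - 1 ∧ h.val = 0 then qSigPlus r else ∅
  | QV.vC h, QV.vC h' =>
      if h'.val = h.val + 1 then ⋃ jj : Fin 3, litLang r (lit h jj) else ∅
  | QV.vC h, QV.top =>
      if h.val = m - 1 then ⋃ jj : Fin 3, litLang r (lit h jj) else ∅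
  | QV.top, QV.top => qSigPlus r
  | QV.bot, QV.bot => qSigPlus r
  | _, _ => ∅

/-- The transition function of `G_φ`: every nonempty word not covered by the specified
transitions leads from any vertex `v ≠ ⊥` to `⊥`. -/
noncomputable def qbfDelta (r m : ℕ) (lit : Fin m → Fin 3 → Fin (2 * r) × Bool) :
    QV r m → QV r m → Set (List (QA r)) := fun v w =>
  if v ≠ QV.bot ∧ w = QV.bot then
    {u | u ≠ [] ∧ ∀ w' : QV r m, u ∉ qbfMain r m lit v w'}
  else qbfMain r m lit v w

/-- The safe set of `G_φ`: everything but `⊥`. -/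
def qbfSafe (r m : ℕ) : Set (QV r m) := {v | v ≠ QV.bot}

/-- The valuation `ι` satisfies the matrix `C₁ ∧ ⋯ ∧ C_m`. -/
def SatisfiesMatrix (r m : ℕ) (lit : Fin m → Fin 3 → Fin (2 * r) × Bool)
    (ι : Fin (2 * r) → Bool) : Prop :=
  ∀ h : Fin m, ∃ j : Fin 3, ι (lit h j).1 = (lit h j).2

/-- A history is `k`-realizable if every consecutive pair of vertices is linked by a
word of length exactly `k` in the transition language. -/
def KRealizable {V A : Type*} (Δ : V → V → Set (List A)) (k : ℕ) (h : List V) : Prop :=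
  List.Chain' (fun u w => ∃ x ∈ Δ u w, x.length = k) h

/-- The vertices from which neither a vertex `vx i` nor `vC₁` can be reached: `⊤`, `⊥` and the
`vC h` other than `vC₁`. -/
def QV.IsDead {r m : ℕ} : QV r m → Prop
  | QV.vC h => h.val ≠ 0
  | QV.top => True
  | QV.bot => True
  | _ => False

/-- Whether `vx i` occurs on a `k`-realizable path from the given vertex to `vC₁`. -/
def QV.Visits {r m : ℕ} (k : ℕ) (i : Fin (2 * r)) : QV r m → Prop
  | QV.v j => j ≤ i ∧ prm i.val ∣ k
  | QV.vx j => j = i ∨ (j < i ∧ prm i.val ∣ k)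
  | QV.vxbar j => j < i ∧ prm i.val ∣ k
  | _ => False

theorem QV.IsDead.step {r m : ℕ} {lit : Fin m → Fin 3 → Fin (2 * r) × Bool} {u w : QV r m}
    (hu : u.IsDead) {x : List (QA r)} (hx : x ∈ qbfDelta r m lit u w) : w.IsDead := by
  cases u <;> cases w <;> simp_all [QV.IsDead, qbfDelta, qbfMain]

/-- The last vertex of a realizable history starting at a dead vertex is dead. -/
theorem QV.IsDead.getLast {r m : ℕ} {lit : Fin m → Fin 3 → Fin (2 * r) × Bool} {k : ℕ}
    {l : List (QV r m)} {u e : QV r m} (hu : u.IsDead)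
    (hl : KRealizable (qbfDelta r m lit) k (u :: l)) (he : (u :: l).getLast? = some e) :
    e.IsDead := by
  induction l generalizing u with
  | nil => simpa [← show u = e by simpa using he] using hu
  | cons w t ih =>
    obtain ⟨⟨x, hx, -⟩, ht⟩ := List.isChain_cons_cons.mp hl
    exact ih (hu.step hx) ht (by simpa using he)

theorem QV.dead_of_vC_step {r m : ℕ} {lit : Fin m → Fin 3 → Fin (2 * r) × Bool} {h : Fin m}
    {w : QV r m} {x : List (QA r)} (hx : x ∈ qbfDelta r m lit (QV.vC h) w) : w.IsDead := by
  cases w <;> simp_all [QV.IsDead, qbfDelta, qbfMain]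

/-- The set of visited `vx i` is determined backwards along a transition between live vertices. -/
theorem QV.visits_step {r m : ℕ} {lit : Fin m → Fin 3 → Fin (2 * r) × Bool} {u w : QV r m}
    {x : List (QA r)} (hx : x ∈ qbfDelta r m lit u w) (hw : ¬ w.IsDead) (i : Fin (2 * r)) :
    u.Visits x.length i ↔ QV.vx i = u ∨ w.Visits x.length i := by
  cases u <;> cases w <;>
    simp [qbfDelta, qbfMain, QV.IsDead] at hx hw <;>
    simp only [QV.Visits, QV.vx.injEq, reduceCtorEq, Fin.le_def, Fin.lt_def, Fin.ext_iff] <;>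
    grind

theorem vx_mem_iff_visits {r m : ℕ} {lit : Fin m → Fin 3 → Fin (2 * r) × Bool} {k : ℕ}
    {l : List (QV r m)} {u : QV r m} {h : Fin m} (h0 : h.val = 0)
    (hl : KRealizable (qbfDelta r m lit) k (u :: l))
    (he : (u :: l).getLast? = some (QV.vC h)) (i : Fin (2 * r)) :
    QV.vx i ∈ u :: l ↔ u.Visits k i := by
  induction l generalizing u with
  | nil =>
    obtain rfl : u = QV.vC h := by simpa using he
    simp [QV.Visits]
  | cons w t ih =>
    obtain ⟨⟨x, hx, rfl⟩, ht⟩ := List.isChain_cons_cons.mp hl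
    have he' : (w :: t).getLast? = some (QV.vC h) := by simpa using he
    have hw : ¬ w.IsDead := fun hw => hw.getLast ht he' h0
    rw [List.mem_cons, ih ht he', QV.visits_step hx hw]

/-- in `G_φ`, for every `k ≥ 1`, every `k`-realizable history `π` from
`v₀` ending at `vC₁`, and every variable `x_{i+1}`: `p_{i+1}` divides `k` iff the
vertex `vx_{i+1}` occurs in `π`. -/
theorem stmt15 (r m : ℕ) (hr : 1 ≤ r) (hm : 1 ≤ m)
    (lit : Fin m → Fin 3 → Fin (2 * r) × Bool)
    (k : ℕ) (hk : 1 ≤ k) (π : List (QV r m))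
    (hπ : IsHist (qbfDelta r m lit) (QV.v ⟨0, by omega⟩) π)
    (hreal : KRealizable (qbfDelta r m lit) k π)
    (hlast : π.getLast? = some (QV.vC ⟨0, by omega⟩)) :
    ∀ i : Fin (2 * r), (prm i.val ∣ k ↔ QV.vx i ∈ π) := by
  intro i
  obtain ⟨-, hhead, -⟩ := hπ
  cases π with
  | nil => simp at hhead
  | cons u l =>
    obtain rfl : u = QV.v ⟨0, by omega⟩ := by simpa using hhead
    rw [vx_mem_iff_visits rfl hreal hlast i]
    simp [QV.Visits, Fin.le_def]
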